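/- Let A be a finite set and v : Finset A → ℝ, and for C ⊆ A let W(C) denote the maximum, over all partitions of C into nonempty parts, of the sum of v over the parts, with W(∅) = 0. Then for every nonempty C ⊆ A, W(C) equals the maximum of v(C) and the maximum, over all unordered pairs {C₁, C₂} of disjoint nonempty sets with C₁ ∪ C₂ = C, of W(C₁) + W(C₂). (This is the classic DP recurrence for coalition structure generation, Equation 1 of the paper, in the case where all coalitions are feasible.) -/

import Mathlib

/-- `π` is a partition of `C` into nonempty parts (in the classic CSG problem every
nonempty coalition is feasible). -/
def IsPartitionInto {A : Type*} [DecidableEq A] (π : Finset (Finset A)) (C : Finset A) : Prop :=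
  (∀ D ∈ π, D.Nonempty) ∧ (π : Set (Finset A)).PairwiseDisjoint id ∧ π.biUnion id = C

/-- `W v C` is the maximum, over all partitions of `C` into nonempty parts, of the sum
of `v` over the parts (with `W v ∅ = 0`, via the empty partition). -/
noncomputable def W {A : Type*} [DecidableEq A] (v : Finset A → ℝ) (C : Finset A) : ℝ :=
  sSup {x : ℝ | ∃ π : Finset (Finset A), IsPartitionInto π C ∧ x = ∑ D ∈ π, v D}

theorem csg_set_finite {A : Type*} [Fintype A] [DecidableEq A] (v : Finset A → ℝ) (C : Finset A) :
    {x : ℝ | ∃ π : Finset (Finset A), IsPartitionInto π C ∧ x = ∑ D ∈ π, v D}.Finite := by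
  refine (Set.finite_range (fun π : Finset (Finset A) => ∑ D ∈ π, v D)).subset ?_
  rintro x ⟨π, -, rfl⟩
  exact ⟨π, rfl⟩

theorem csg_le_W {A : Type*} [Fintype A] [DecidableEq A] (v : Finset A → ℝ) {C : Finset A}
    {π : Finset (Finset A)} (h : IsPartitionInto π C) : ∑ D ∈ π, v D ≤ W v C :=
  le_csSup (csg_set_finite v C).bddAbove ⟨π, h, rfl⟩

theorem csg_single {A : Type*} [DecidableEq A] {C : Finset A} (hC : C.Nonempty) :
    IsPartitionInto {C} C := by
  refine ⟨by simpa using hC, by simp, by simp⟩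

theorem csg_W_attained {A : Type*} [Fintype A] [DecidableEq A] (v : Finset A → ℝ) {C : Finset A}
    (hC : C.Nonempty) : ∃ π, IsPartitionInto π C ∧ W v C = ∑ D ∈ π, v D :=
  Set.Nonempty.csSup_mem (s := {x : ℝ | ∃ π : Finset (Finset A),
    IsPartitionInto π C ∧ x = ∑ D ∈ π, v D}) ⟨_, {C}, csg_single hC, rfl⟩ (csg_set_finite v C)

theorem csg_union {A : Type*} [DecidableEq A] {C₁ C₂ : Finset A} {π₁ π₂ : Finset (Finset A)}
    (h₁ : IsPartitionInto π₁ C₁) (h₂ : IsPartitionInto π₂ C₂) (hd : Disjoint C₁ C₂) :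
    Disjoint π₁ π₂ ∧ IsPartitionInto (π₁ ∪ π₂) (C₁ ∪ C₂) := by
  obtain ⟨n₁, d₁, u₁⟩ := h₁
  obtain ⟨n₂, d₂, u₂⟩ := h₂
  have s₁ : ∀ D ∈ π₁, D ⊆ C₁ := fun D hD => u₁ ▸ Finset.subset_biUnion_of_mem id hD
  have s₂ : ∀ D ∈ π₂, D ⊆ C₂ := fun D hD => u₂ ▸ Finset.subset_biUnion_of_mem id hD
  have hx : ∀ D ∈ π₁, ∀ E ∈ π₂, Disjoint D E := fun D hD E hE =>
    Finset.disjoint_of_subset_left (s₁ D hD) (Finset.disjoint_of_subset_right (s₂ E hE) hd)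
  refine ⟨?_, ?_, ?_, ?_⟩
  · rw [Finset.disjoint_left]
    intro D hD hD'
    exact (n₁ D hD).ne_empty (disjoint_self.1 (hx D hD D hD'))
  · intro D hD
    rcases Finset.mem_union.1 hD with h | h
    exacts [n₁ D h, n₂ D h]
  · rw [Finset.coe_union, Set.pairwiseDisjoint_union]
    exact ⟨d₁, d₂, fun D hD E hE _ => hx D hD E hE⟩
  · rw [Finset.union_biUnion, u₁, u₂]

theorem classic_dp_recurrence {A : Type*} [Fintype A] [DecidableEq A]
    (v : Finset A → ℝ) (C : Finset A) (hC : C.Nonempty) :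
    W v C =
      sSup (insert (v C)
        {x : ℝ | ∃ C₁ C₂ : Finset A, C₁.Nonempty ∧ C₂.Nonempty ∧
          Disjoint C₁ C₂ ∧ C₁ ∪ C₂ = C ∧ x = W v C₁ + W v C₂}) := by
  have hfin : (insert (v C)
        {x : ℝ | ∃ C₁ C₂ : Finset A, C₁.Nonempty ∧ C₂.Nonempty ∧
          Disjoint C₁ C₂ ∧ C₁ ∪ C₂ = C ∧ x = W v C₁ + W v C₂}).Finite := by
    refine Set.Finite.insert _ ((Set.finite_range
      (fun p : Finset A × Finset A => W v p.1 + W v p.2)).subset ?_)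
    rintro x ⟨C₁, C₂, -, -, -, -, rfl⟩
    exact ⟨(C₁, C₂), rfl⟩
  apply le_antisymm
  · obtain ⟨π, hπ, hW⟩ := csg_W_attained v hC
    rw [hW]
    obtain ⟨n, d, u⟩ := hπ
    have hne : π.Nonempty := by
      rw [Finset.nonempty_iff_ne_empty]
      rintro rfl
      simp at u
      exact hC.ne_empty u.symm
    obtain ⟨D, hD⟩ := hne
    have hins : insert D (π.erase D) = π := Finset.insert_erase hD
    rcases (π.erase D).eq_empty_or_nonempty with he | ⟨E, hE⟩
    · rw [he] at hins
      subst hins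
      have hDC : D = C := by simpa using u
      subst hDC
      exact le_csSup hfin.bddAbove (Set.mem_insert_iff.2 (Or.inl (by simp)))
    · have h₂ : IsPartitionInto (π.erase D) ((π.erase D).biUnion id) :=
        ⟨fun F hF => n F (Finset.mem_of_mem_erase hF),
          d.subset (by exact_mod_cast Finset.erase_subset D π), rfl⟩
      have h₁ := csg_single (n D hD)
      have hle : ∑ F ∈ π, v F ≤ W v D + W v ((π.erase D).biUnion id) := by
        rw [← Finset.add_sum_erase π v hD]
        have a := csg_le_W v h₁
        rw [Finset.sum_singleton] at a
        exact add_le_add a (csg_le_W v h₂)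
      refine hle.trans (le_csSup hfin.bddAbove (Set.mem_insert_of_mem _
        ⟨D, _, n D hD, ?_, ?_, ?_, rfl⟩))
      · exact (n E (Finset.mem_of_mem_erase hE)).mono (Finset.subset_biUnion_of_mem id hE)
      · rw [Finset.disjoint_biUnion_right]
        intro F hF
        exact d hD (Finset.mem_of_mem_erase hF) (Finset.ne_of_mem_erase hF).symm
      · rw [← u]
        conv_rhs => rw [← hins, Finset.biUnion_insert]
        rfl
  · refine csSup_le (Set.insert_nonempty _ _) ?_
    rintro x (rfl | ⟨C₁, C₂, hn₁, hn₂, hd, rfl, rfl⟩)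
    · have a := csg_le_W v (csg_single hC)
      rwa [Finset.sum_singleton] at a
    · obtain ⟨π₁, h₁, e₁⟩ := csg_W_attained v hn₁
      obtain ⟨π₂, h₂, e₂⟩ := csg_W_attained v hn₂
      obtain ⟨hdis, hp⟩ := csg_union h₁ h₂ hd
      rw [e₁, e₂, ← Finset.sum_union hdis]
      exact csg_le_W v hp
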